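/- Let A₀ : {1,…,N} × {1,…,N} → ℝ be an attention map such that m^c(A₀) and n^c(A₀) are not integers and ⌊m^c(A₀)⌋, ⌊n^c(A₀)⌋ ∈ {1,…,N}. Then the progressively focused loss L_PF, viewed as a real-valued function on ℝ^{N×N}, is differentiable at A₀. -/

import Mathlib

open Filter Topology

/-- The floor is locally constant at every non-integer. -/
theorem eventually_floor_eq_of_forall_ne_intCast {x : ℝ} (hx : ∀ z : ℤ, x ≠ (z : ℝ)) :
    ∀ᶠ y in 𝓝 x, ⌊y⌋ = ⌊x⌋ := by
  have hlt : (⌊x⌋ : ℝ) < x := lt_of_le_of_ne (Int.floor_le x) (hx _).symm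
  filter_upwards [Ioo_mem_nhds hlt (Int.lt_floor_add_one x)] with y hy
  exact Int.floor_eq_iff.mpr ⟨hy.1.le, hy.2⟩

/-- A grid index determined by the floor is locally constant at every non-integer whose floor
lies in the grid. -/
theorem eventually_gridIndex_eq {N : ℕ} {idx : ℝ → Fin N}
    (hidx : ∀ x : ℝ, 1 ≤ ⌊x⌋ → ⌊x⌋ ≤ (N : ℤ) → (((idx x : ℕ) : ℤ) + 1 = ⌊x⌋))
    {x : ℝ} (hx : ∀ z : ℤ, x ≠ (z : ℝ)) (hlb : 1 ≤ ⌊x⌋) (hub : ⌊x⌋ ≤ (N : ℤ)) :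
    ∀ᶠ y in 𝓝 x, idx y = idx x := by
  filter_upwards [eventually_floor_eq_of_forall_ne_intCast hx] with y hy
  have hix := hidx x hlb hub
  have hiy := hidx y (hy ▸ hlb) (hy ▸ hub)
  exact Fin.ext (by omega)


/-- **Differentiability of the progressively focused loss.**
The attention map is `A : Fin N → Fin N → ℝ` on an `N × N` pixel grid, where the
pixel `(m, n)` (for `m, n : Fin N`) has integer coordinates `(m + 1, n + 1) ∈ {1,…,N}²`.
The center of mass is `m^c(A) = (1/N²) ∑_{m,n} m · A(m,n)`,
`n^c(A) = (1/N²) ∑_{m,n} n · A(m,n)`.  The map `idx : ℝ → Fin N` converts a real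
coordinate `x` with `⌊x⌋ ∈ {1,…,N}` to the corresponding grid index (i.e.
`idx x + 1 = ⌊x⌋`).  The progressively focused loss is
`L_PF(A) = − ∑_{m,n} (A(m,n) − A(⌊m^c(A)⌋, ⌊n^c(A)⌋))² / √((m − m^c(A))² + (n − n^c(A))²)`.
If `A₀` is an attention map such that `m^c(A₀)` and `n^c(A₀)` are not integers and
`⌊m^c(A₀)⌋, ⌊n^c(A₀)⌋ ∈ {1,…,N}`, then `L_PF` is differentiable at `A₀`. -/
theorem progressively_focused_loss_differentiableAt
    (N : ℕ)
    (mc nc : (Fin N → Fin N → ℝ) → ℝ)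
    (hmc : ∀ A, mc A = (1 / (N : ℝ) ^ 2) *
      ∑ m : Fin N, ∑ n : Fin N, (((m : ℕ) : ℝ) + 1) * A m n)
    (hnc : ∀ A, nc A = (1 / (N : ℝ) ^ 2) *
      ∑ m : Fin N, ∑ n : Fin N, (((n : ℕ) : ℝ) + 1) * A m n)
    (idx : ℝ → Fin N)
    (hidx : ∀ x : ℝ, 1 ≤ ⌊x⌋ → ⌊x⌋ ≤ (N : ℤ) → (((idx x : ℕ) : ℤ) + 1 = ⌊x⌋))
    (LPF : (Fin N → Fin N → ℝ) → ℝ)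
    (hLPF : ∀ A, LPF A = - ∑ m : Fin N, ∑ n : Fin N,
      (A m n - A (idx (mc A)) (idx (nc A))) ^ 2 /
        Real.sqrt (((((m : ℕ) : ℝ) + 1) - mc A) ^ 2 + ((((n : ℕ) : ℝ) + 1) - nc A) ^ 2))
    (A₀ : Fin N → Fin N → ℝ)
    (hm_not_int : ∀ z : ℤ, mc A₀ ≠ (z : ℝ))
    (hn_not_int : ∀ z : ℤ, nc A₀ ≠ (z : ℝ))
    (hm_lb : 1 ≤ ⌊mc A₀⌋) (hm_ub : ⌊mc A₀⌋ ≤ (N : ℤ))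
    (hn_lb : 1 ≤ ⌊nc A₀⌋) (hn_ub : ⌊nc A₀⌋ ≤ (N : ℤ)) :
    DifferentiableAt ℝ LPF A₀ := by
  have hmd : Differentiable ℝ mc := by
    rw [funext hmc]
    fun_prop
  have hnd : Differentiable ℝ nc := by
    rw [funext hnc]
    fun_prop
  have hloc : LPF =ᶠ[𝓝 A₀] fun A => - ∑ m : Fin N, ∑ n : Fin N,
      (A m n - A (idx (mc A₀)) (idx (nc A₀))) ^ 2 /
        Real.sqrt (((((m : ℕ) : ℝ) + 1) - mc A) ^ 2 + ((((n : ℕ) : ℝ) + 1) - nc A) ^ 2) := by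
    filter_upwards [hmd.continuous.continuousAt.eventually
        (eventually_gridIndex_eq hidx hm_not_int hm_lb hm_ub),
      hnd.continuous.continuousAt.eventually
        (eventually_gridIndex_eq hidx hn_not_int hn_lb hn_ub)] with A hmA hnA
    rw [hLPF, hmA, hnA]
  refine DifferentiableAt.congr_of_eventuallyEq ?_ hloc
  refine (DifferentiableAt.fun_sum fun m _ => DifferentiableAt.fun_sum fun n _ => ?_).fun_neg
  have hpos : 0 < ((((m : ℕ) : ℝ) + 1) - mc A₀) ^ 2 + ((((n : ℕ) : ℝ) + 1) - nc A₀) ^ 2 := by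
    have hne : (((m : ℕ) : ℝ) + 1) - mc A₀ ≠ 0 := fun h =>
      hm_not_int ((m : ℕ) + 1) (by push_cast; linarith)
    positivity
  have hden : DifferentiableAt ℝ (fun A => Real.sqrt
      (((((m : ℕ) : ℝ) + 1) - mc A) ^ 2 + ((((n : ℕ) : ℝ) + 1) - nc A) ^ 2)) A₀ :=
    DifferentiableAt.sqrt (by fun_prop) hpos.ne'
  simp only [div_eq_mul_inv]
  exact DifferentiableAt.fun_mul (by fun_prop) (hden.fun_inv (Real.sqrt_pos.mpr hpos).ne')
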